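/- arXiv:1812.01159 — 4 statements merged into one kernel-verified Lean document; each statement's English description precedes it below -/
import Mathlib

section
/- Let g be a Lie algebra over a field K of characteristic zero, U(g) its universal enveloping algebra with canonical map ι : g → U(g), and |U(g)| := U(g)/[U(g),U(g)], with projection u ↦ |u|. For each integer m ≥ 0 let W_m ⊆ |U(g)| be the K-linear span of the set {|ι(x)^m| : x ∈ g}. Then |U(g)| is the internal direct sum of the family of subspaces (W_m)_{m≥0}; that is, the subspaces W_m are linearly independent and their sum is all of |U(g)|. (This is Theorem 3.1, |U(g)| = ⊕_{m≥0} |Sym^m g|, using that Sym^m g is spanned by m-th powers x^m, whose PBW symmetrization in U(g) is ι(x)^m.) -/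
/-!
STATEMENT 0: For a Lie algebra `g` over a field `K` of characteristic zero, the trace space
`|U(g)| = U(g)/[U(g),U(g)]` is the internal direct sum of the subspaces
`W_m = span K {|ι(x)^m| : x ∈ g}` for `m ≥ 0`.
-/

noncomputable section

variable (K : Type*) [Field K] (g : Type*) [LieRing g] [LieAlgebra K g]

/-- The linear span of commutators `a*b - b*a` in the universal enveloping algebra. -/
def commSpan : Submodule K (UniversalEnvelopingAlgebra K g) :=
  Submodule.span K {x | ∃ a b : UniversalEnvelopingAlgebra K g, x = a * b - b * a}

/-- The projection `u ↦ |u|` from `U(g)` onto `|U(g)| = U(g)/[U(g),U(g)]`. -/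
def tr : UniversalEnvelopingAlgebra K g →ₗ[K]
    UniversalEnvelopingAlgebra K g ⧸ commSpan K g :=
  (commSpan K g).mkQ

section Powers

variable {K} {A : Type*} [Ring A] [Algebra K A]

/-- If a polynomial map with coefficients in a vector space takes values in a subspace, then its
coefficients lie in this subspace. -/
lemma Submodule.coeff_mem_of_forall_sum_pow_smul_mem [Infinite K] {V : Type*} [AddCommGroup V]
    [Module K V] (S : Submodule K V) (n : ℕ) (c : ℕ → V)
    (h : ∀ t : K, ∑ k ∈ Finset.range n, t ^ k • c k ∈ S) {k : ℕ} (hk : k < n) : c k ∈ S := by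
  rw [← Submodule.Quotient.mk_eq_zero, ← Module.forall_dual_apply_eq_zero_iff K]
  intro φ
  let p : Polynomial K :=
    ∑ i ∈ Finset.range n, Polynomial.monomial i (φ (Submodule.Quotient.mk (c i)))
  have hp : p = 0 := by
    refine Polynomial.funext fun t ↦ ?_
    have := congrArg φ ((Submodule.Quotient.mk_eq_zero S).2 (h t))
    rw [← Submodule.mkQ_apply] at this
    simpa [p, Polynomial.eval_finsetSum, mul_comm] using this
  have := congrArg (fun q ↦ Polynomial.coeff q k) hp
  simpa [p, Polynomial.coeff_monomial, hk] using this

/-- The first two terms of the expansion of `(x + t y) ^ n` in powers of the scalar `t`. -/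
lemma exists_add_smul_pow_eq_sum (x y : A) (n : ℕ) :
    ∃ c : ℕ → A, c 0 = x ^ n ∧ c 1 = ∑ i ∈ Finset.range n, x ^ i * y * x ^ (n - 1 - i) ∧
      ∀ t : K, (x + t • y) ^ n = ∑ k ∈ Finset.range (n + 1), t ^ k • c k := by
  suffices ∃ c : ℕ → A, c 0 = x ^ n ∧ c 1 = ∑ i ∈ Finset.range n, x ^ i * y * x ^ (n - 1 - i) ∧
      c (n + 1) = 0 ∧ ∀ t : K, (x + t • y) ^ n = ∑ k ∈ Finset.range (n + 1), t ^ k • c k by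
    obtain ⟨c, h₀, h₁, -, h⟩ := this
    exact ⟨c, h₀, h₁, h⟩
  induction n with
  | zero => exact ⟨fun k ↦ if k = 0 then 1 else 0, by simp⟩
  | succ n ih =>
    obtain ⟨c, h₀, h₁, hn, h⟩ := ih
    refine ⟨fun k ↦ if k = n + 2 then 0 else
      Nat.casesOn k (x * c 0) fun j ↦ x * c (j + 1) + y * c j, ?_, ?_, by simp, fun t ↦ ?_⟩
    · simp [h₀, pow_succ']
    · rw [Finset.sum_range_succ']
      simp [h₀, h₁, Finset.mul_sum, pow_succ', mul_assoc, Nat.sub_sub, add_comm 1]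
    · have hx : ∑ k ∈ Finset.range (n + 1), t ^ k • c k =
          ∑ k ∈ Finset.range (n + 1), t ^ (k + 1) • c (k + 1) + c 0 := by
        have := Finset.sum_range_succ (fun k ↦ t ^ k • c k) (n + 1)
        rw [Finset.sum_range_succ'] at this
        simpa [hn] using this.symm
      rw [pow_succ', h, add_mul, Finset.sum_range_succ' _ (n + 1)]
      nth_rewrite 1 [hx]
      rw [mul_add, Finset.mul_sum, Finset.mul_sum, add_right_comm, ← Finset.sum_add_distrib]
      congr 1
      · refine Finset.sum_congr rfl fun k hk ↦ ?_
        have : k ≠ n + 1 := by have := Finset.mem_range.1 hk; omega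
        simp [this, pow_succ, smul_smul]
      · simp

end Powers

namespace UniversalEnvelopingAlgebra

open TensorProduct

attribute [local instance] LieRing.ofAssociativeRing

variable {g}

/-- An induction principle: the universal enveloping algebra is generated by `g`. -/
lemma induction_on {p : UniversalEnvelopingAlgebra K g → Prop}
    (u : UniversalEnvelopingAlgebra K g) (algebraMap : ∀ r : K, p (algebraMap K _ r))
    (ι : ∀ x : g, p (ι K x)) (mul : ∀ a b, p a → p b → p (a * b))
    (add : ∀ a b, p a → p b → p (a + b)) : p u := by
  let s : Subalgebra K (UniversalEnvelopingAlgebra K g) :=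
    { carrier := {a | p a}
      mul_mem' := fun ha hb ↦ mul _ _ ha hb
      add_mem' := fun ha hb ↦ add _ _ ha hb
      algebraMap_mem' := algebraMap }
  let f : g →ₗ⁅K⁆ s :=
    { ((UniversalEnvelopingAlgebra.ι K : g →ₗ⁅K⁆ _) : g →ₗ[K] _).codRestrict
        (Subalgebra.toSubmodule s) ι with
      map_lie' := fun {x y} ↦ by
        refine Subtype.ext ?_
        exact (UniversalEnvelopingAlgebra.ι K).map_lie x y }
  have h : s.val.comp (lift K f) = AlgHom.id K _ := by
    ext x
    exact congrArg Subtype.val (lift_ι_apply K f x)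
  have hu : (lift K f u : UniversalEnvelopingAlgebra K g) = u := DFunLike.congr_fun h u
  rw [← hu]
  exact (lift K f u).2

/-- The comultiplication of the universal enveloping algebra, for which the elements of `g` are
primitive. -/
def comul : UniversalEnvelopingAlgebra K g →ₐ[K]
    UniversalEnvelopingAlgebra K g ⊗[K] UniversalEnvelopingAlgebra K g :=
  lift K
    { toFun := fun x ↦ ι K x ⊗ₜ 1 + 1 ⊗ₜ ι K x
      map_add' := fun x y ↦ by
        simp only [map_add, TensorProduct.add_tmul, TensorProduct.tmul_add]; abel
      map_smul' := fun r x ↦ by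
        simp [TensorProduct.smul_tmul']
      map_lie' := fun {x y} ↦ by
        simp only [LieHom.map_lie, LieRing.of_associative_ring_bracket, add_mul, mul_add,
          Algebra.TensorProduct.tmul_mul_tmul, one_mul, mul_one, TensorProduct.sub_tmul,
          TensorProduct.tmul_sub]
        abel }

lemma comul_ι (x : g) : comul K (ι K x) = ι K x ⊗ₜ 1 + 1 ⊗ₜ ι K x :=
  lift_ι_apply K _ x

/-- The second Adams operation, that is, the convolution square of the identity. -/
def adams : UniversalEnvelopingAlgebra K g →ₗ[K] UniversalEnvelopingAlgebra K g :=
  LinearMap.mul' K _ ∘ₗ (comul K).toLinearMap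

lemma adams_ι_pow (x : g) (m : ℕ) : adams K (ι K x ^ m) = (2 : K) ^ m • ι K x ^ m := by
  have hc : Commute (ι K x ⊗ₜ[K] (1 : UniversalEnvelopingAlgebra K g))
      ((1 : UniversalEnvelopingAlgebra K g) ⊗ₜ[K] ι K x) := by
    simp [Commute, SemiconjBy]
  have : adams K (ι K x ^ m) = ∑ k ∈ Finset.range (m + 1), m.choose k • ι K x ^ m := by
    simp only [adams, LinearMap.comp_apply, AlgHom.toLinearMap_apply, map_pow, comul_ι, hc.add_pow,
      map_sum]
    refine Finset.sum_congr rfl fun k hk ↦ ?_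
    rw [← nsmul_eq_mul', map_nsmul]
    simp [← pow_add, Nat.add_sub_cancel' (Finset.mem_range_succ_iff.1 hk)]
  rw [this, ← Finset.sum_smul, Nat.sum_range_choose, ← Nat.cast_smul_eq_nsmul K]
  simp

lemma adams_ι_commutator (x : g) (u : UniversalEnvelopingAlgebra K g) :
    adams K (ι K x * u - u * ι K x) = ι K x * adams K u - adams K u * ι K x := by
  simp only [adams, LinearMap.comp_apply, AlgHom.toLinearMap_apply, map_sub, map_mul, comul_ι]
  induction comul K u using TensorProduct.induction_on with
  | zero => simp
  | tmul a b =>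
    simp only [add_mul, mul_add, Algebra.TensorProduct.tmul_mul_tmul, map_add,
      LinearMap.mul'_apply, one_mul, mul_one, mul_assoc]
    abel
  | add v w hv hw =>
    simp only [mul_add, add_mul, map_add] at hv hw ⊢
    convert congrArg₂ (· + ·) hv hw using 1 <;> abel

variable (g) in
lemma commSpan_le_comap_adams : commSpan K g ≤ (commSpan K g).comap (adams K) := by
  refine Submodule.span_le.2 ?_
  rintro _ ⟨a, b, rfl⟩
  change adams K (a * b - b * a) ∈ commSpan K g
  induction a using induction_on generalizing b with
  | algebraMap r => simp [Algebra.commutes]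
  | ι x => rw [adams_ι_commutator]; exact Submodule.subset_span ⟨_, _, rfl⟩
  | mul a a' ha ha' =>
    have : a * a' * b - b * (a * a') =
        (a * (a' * b) - a' * b * a) + (a' * (b * a) - b * a * a') := by
      noncomm_ring
    rw [this, map_add]
    exact add_mem (ha _) (ha' _)
  | add a a' ha ha' =>
    have : (a + a') * b - b * (a + a') = (a * b - b * a) + (a' * b - b * a') := by
      noncomm_ring
    rw [this, map_add]
    exact add_mem (ha _) (ha' _)

variable (g) in
/-- The span of all powers of elements of `g`. -/
def powSpan : Submodule K (UniversalEnvelopingAlgebra K g) :=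
  Submodule.span K {u | ∃ (x : g) (m : ℕ), u = ι K x ^ m}

lemma ι_pow_mem_powSpan (x : g) (m : ℕ) : ι K x ^ m ∈ powSpan K g :=
  Submodule.subset_span ⟨x, m, rfl⟩

lemma sum_pow_mul_ι_mul_pow_mem_powSpan [Infinite K] (x y : g) (m : ℕ) :
    ∑ i ∈ Finset.range (m + 1), ι K x ^ i * ι K y * ι K x ^ (m - i) ∈ powSpan K g := by
  obtain ⟨c, -, h₁, h⟩ := exists_add_smul_pow_eq_sum (K := K) (ι K x) (ι K y) (m + 1)
  rw [Nat.add_sub_cancel] at h₁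
  rw [← h₁]
  refine Submodule.coeff_mem_of_forall_sum_pow_smul_mem _ (m + 1 + 1) c (fun t ↦ ?_) (by omega)
  rw [← h, ← map_smul, ← map_add]
  exact ι_pow_mem_powSpan K _ _

lemma pow_mul_ι_mul_pow_mem_powSpan [CharZero K] (x y : g) (i j : ℕ) :
    ι K x ^ i * ι K y * ι K x ^ j ∈ powSpan K g := by
  obtain ⟨m, hm⟩ : ∃ m, i + j = m := ⟨_, rfl⟩
  induction m generalizing y i j with
  | zero =>
    obtain ⟨rfl, rfl⟩ : i = 0 ∧ j = 0 := by omega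
    simpa using ι_pow_mem_powSpan K y 1
  | succ m ih =>
    have step : ∀ k ≤ m + 1, ι K x ^ k * ι K y * ι K x ^ (m + 1 - k) -
        ι K y * ι K x ^ (m + 1) ∈ powSpan K g := by
      intro k hk
      induction k with
      | zero => simp
      | succ k ihk =>
        have hl := ih ⁅x, y⁆ k (m - k) (by omega)
        have e : m + 1 - k = m - k + 1 := by omega
        have := add_mem (ihk (by omega)) hl
        rw [e, LieHom.map_lie, LieRing.of_associative_ring_bracket] at this
        rw [Nat.add_sub_add_right]
        convert this using 1
        simp only [pow_succ (ι K x) k, pow_succ' (ι K x) (m - k), mul_sub, sub_mul, mul_assoc]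
        abel
    have hy : ι K y * ι K x ^ (m + 1) ∈ powSpan K g := by
      have := sub_mem (sum_pow_mul_ι_mul_pow_mem_powSpan K x y (m + 1))
        (sum_mem fun k hk ↦ step k (Finset.mem_range_succ_iff.1 hk))
      rw [← Finset.sum_sub_distrib] at this
      simp only [sub_sub_cancel, Finset.sum_const, Finset.card_range,
        ← Nat.cast_smul_eq_nsmul K] at this
      exact ((powSpan K g).smul_mem_iff (Nat.cast_ne_zero.2 (by omega))).1 this
    have := add_mem (step i (by omega)) hy
    rwa [sub_add_cancel, ← hm, Nat.add_sub_cancel_left] at this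

variable (g) in
/-- The universal enveloping algebra is spanned by the powers of the elements of `g`. -/
lemma powSpan_eq_top [CharZero K] : powSpan K g = ⊤ := by
  have key : ∀ u, ∀ v ∈ powSpan K g, u * v ∈ powSpan K g := by
    intro u
    induction u using induction_on with
    | algebraMap r =>
      intro v hv
      rw [← Algebra.smul_def]
      exact Submodule.smul_mem _ _ hv
    | ι y =>
      intro v hv
      induction hv using Submodule.span_induction with
      | mem v hv =>
        obtain ⟨x, m, rfl⟩ := hv
        simpa using pow_mul_ι_mul_pow_mem_powSpan K x y 0 m
      | zero => simp
      | add v w _ _ hv hw => rw [mul_add]; exact add_mem hv hw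
      | smul r v _ hv => rw [mul_smul_comm]; exact Submodule.smul_mem _ _ hv
    | mul a b ha hb => intro v hv; rw [mul_assoc]; exact ha _ (hb _ hv)
    | add a b ha hb => intro v hv; rw [add_mul]; exact add_mem (ha _ hv) (hb _ hv)
  refine eq_top_iff.2 fun u _ ↦ ?_
  simpa using key u 1 (by simpa using ι_pow_mem_powSpan K (0 : g) 0)

end UniversalEnvelopingAlgebra

theorem stmt0 [CharZero K] :
    DirectSum.IsInternal (fun m : ℕ =>
      Submodule.span K
        {y : UniversalEnvelopingAlgebra K g ⧸ commSpan K g |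
          ∃ x : g, y = tr K g ((UniversalEnvelopingAlgebra.ι K x) ^ m)}) := by
  have hinj : Function.Injective fun m : ℕ ↦ (2 : K) ^ m := fun a b h ↦ by
    have h' : ((2 ^ a : ℕ) : K) = ((2 ^ b : ℕ) : K) := by simpa using h
    exact Nat.pow_right_injective le_rfl (Nat.cast_injective h')
  let ψ : Module.End K (UniversalEnvelopingAlgebra K g ⧸ commSpan K g) :=
    (commSpan K g).mapQ (commSpan K g) (UniversalEnvelopingAlgebra.adams K)
      (UniversalEnvelopingAlgebra.commSpan_le_comap_adams K g)
  refine DirectSum.isInternal_submodule_of_iSupIndep_of_iSup_eq_top ?_ ?_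
  · refine ((Module.End.eigenspaces_iSupIndep ψ).comp hinj).mono fun m ↦ Submodule.span_le.2 ?_
    rintro _ ⟨x, rfl⟩
    refine Module.End.mem_eigenspace_iff.2 ?_
    simp only [ψ, tr, Submodule.mkQ_apply, Submodule.mapQ_apply,
      UniversalEnvelopingAlgebra.adams_ι_pow, Submodule.Quotient.mk_smul]
  · rw [eq_top_iff, ← (commSpan K g).range_mkQ, LinearMap.range_eq_map,
      ← UniversalEnvelopingAlgebra.powSpan_eq_top, UniversalEnvelopingAlgebra.powSpan,
      Submodule.map_span_le]
    rintro _ ⟨x, m, rfl⟩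
    exact Submodule.mem_iSup_of_mem m (Submodule.subset_span ⟨x, rfl⟩)

end
end

section
/- Let g be a Lie algebra over a field K of characteristic zero, u, v ∈ g, and N ≥ 0 an integer. If Σ_{m=0}^{N} (1/m!)·|ι(u)^m| = Σ_{m=0}^{N} (1/m!)·|ι(v)^m| in |U(g)|, then |ι(u)^m| = |ι(v)^m| for every 0 ≤ m ≤ N. (This is the finite-degree form of Theorem 3.2, whose completed version states: if u, v lie in the completed free Lie algebra and |exp(u)| = |exp(v)| in the completed tensor algebra, then |u^m| = |v^m| for all m ≥ 0.) -/
/-!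
STATEMENT 1 (finite-degree form of Theorem 3.2): if
`Σ_{m=0}^{N} (1/m!)·|ι(u)^m| = Σ_{m=0}^{N} (1/m!)·|ι(v)^m|` in `|U(g)|`, then
`|ι(u)^m| = |ι(v)^m|` for every `0 ≤ m ≤ N`.
-/

noncomputable section

variable (K : Type*) [Field K] (g : Type*) [LieRing g] [LieAlgebra K g]

section AdamsOperation

open scoped TensorProduct

attribute [local instance] LieRing.ofAssociativeRing

variable {K} in
/-- The map `x ↦ x ⊗ 1 + 1 ⊗ x` as a morphism of Lie algebras. -/
def primitiveLieHom (A : Type*) [Ring A] [Algebra K A] : A →ₗ⁅K⁆ A ⊗[K] A :=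
  { (TensorProduct.mk K A A).flip 1 + TensorProduct.mk K A A 1 with
    map_lie' := fun {x y} => by
      change ⁅x, y⁆ ⊗ₜ[K] (1 : A) + (1 : A) ⊗ₜ[K] ⁅x, y⁆ =
        ⁅x ⊗ₜ[K] (1 : A) + (1 : A) ⊗ₜ[K] x, y ⊗ₜ[K] (1 : A) + (1 : A) ⊗ₜ[K] y⁆
      simp only [LieRing.of_associative_ring_bracket, mul_add, add_mul,
        Algebra.TensorProduct.tmul_mul_tmul, one_mul, mul_one, TensorProduct.sub_tmul,
        TensorProduct.tmul_sub]
      abel }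

/-- The comultiplication of the universal enveloping algebra, for which `g` is primitive. -/
def envelopingComul : UniversalEnvelopingAlgebra K g →ₐ[K]
    UniversalEnvelopingAlgebra K g ⊗[K] UniversalEnvelopingAlgebra K g :=
  UniversalEnvelopingAlgebra.lift K
    ((primitiveLieHom (UniversalEnvelopingAlgebra K g)).comp (UniversalEnvelopingAlgebra.ι K))

/-- The second Adams operation: comultiplication followed by multiplication. -/
def adamsTwo : UniversalEnvelopingAlgebra K g →ₗ[K] UniversalEnvelopingAlgebra K g :=
  LinearMap.mul' K (UniversalEnvelopingAlgebra K g) ∘ₗ (envelopingComul K g).toLinearMap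

variable {K g}

theorem envelopingComul_ι (x : g) :
    envelopingComul K g (UniversalEnvelopingAlgebra.ι K x) =
      UniversalEnvelopingAlgebra.ι K x ⊗ₜ[K] 1 + 1 ⊗ₜ[K] UniversalEnvelopingAlgebra.ι K x := by
  rw [envelopingComul, UniversalEnvelopingAlgebra.lift_ι_apply]
  rfl

theorem adamsTwo_apply (a : UniversalEnvelopingAlgebra K g) :
    adamsTwo K g a = LinearMap.mul' K _ (envelopingComul K g a) :=
  rfl

/-- Multiplication `A ⊗ A → A` intertwines commutation with `x ⊗ 1 + 1 ⊗ x` and with `x`. -/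
theorem mul'_commutator_primitive {A : Type*} [Ring A] [Algebra K A] (x : A) (t : A ⊗[K] A) :
    LinearMap.mul' K A ((x ⊗ₜ 1 + 1 ⊗ₜ x) * t - t * (x ⊗ₜ 1 + 1 ⊗ₜ x)) =
      x * LinearMap.mul' K A t - LinearMap.mul' K A t * x := by
  induction t with
  | zero => simp
  | tmul a b =>
    simp only [mul_add, add_mul, Algebra.TensorProduct.tmul_mul_tmul, one_mul, mul_one, map_sub,
      map_add, LinearMap.mul'_apply, mul_assoc]
    abel
  | add s t hs ht =>
    rw [map_add, mul_add x, add_mul _ _ x, add_sub_add_comm, ← hs, ← ht, ← map_add]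
    congr 1
    rw [mul_add _ s t, add_mul s t, add_sub_add_comm]

theorem mul'_primitive_pow {A : Type*} [Ring A] [Algebra K A] (x : A) (m : ℕ) :
    LinearMap.mul' K A ((x ⊗ₜ 1 + 1 ⊗ₜ x) ^ m) = (2 : K) ^ m • x ^ m := by
  have hc : Commute (x ⊗ₜ[K] (1 : A)) ((1 : A) ⊗ₜ[K] x) := by
    simp [Commute, SemiconjBy, Algebra.TensorProduct.tmul_mul_tmul]
  have hterm (i : ℕ) (hi : i ∈ Finset.range (m + 1)) :
      LinearMap.mul' K A ((x ⊗ₜ[K] (1 : A)) ^ i * ((1 : A) ⊗ₜ[K] x) ^ (m - i) *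
        (m.choose i : A ⊗[K] A)) = (m.choose i : K) • x ^ m := by
    rw [← nsmul_eq_mul', map_nsmul, Algebra.TensorProduct.tmul_pow, Algebra.TensorProduct.tmul_pow,
      Algebra.TensorProduct.tmul_mul_tmul, LinearMap.mul'_apply, one_pow, one_pow, one_mul, mul_one,
      ← pow_add, Nat.add_sub_of_le (Finset.mem_range_succ_iff.mp hi), Nat.cast_smul_eq_nsmul]
  rw [hc.add_pow, map_sum, Finset.sum_congr rfl hterm, ← Finset.sum_smul, ← Nat.cast_sum,
    Nat.sum_range_choose, Nat.cast_pow, Nat.cast_ofNat]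

theorem adamsTwo_ι_pow (x : g) (m : ℕ) :
    adamsTwo K g (UniversalEnvelopingAlgebra.ι K x ^ m) =
      (2 : K) ^ m • UniversalEnvelopingAlgebra.ι K x ^ m := by
  rw [adamsTwo_apply, map_pow, envelopingComul_ι, mul'_primitive_pow]

theorem commutator_mem_commSpan (a b : UniversalEnvelopingAlgebra K g) :
    a * b - b * a ∈ commSpan K g :=
  Submodule.subset_span ⟨a, b, rfl⟩

theorem UniversalEnvelopingAlgebra.mkAlgHom_surjective :
    Function.Surjective (UniversalEnvelopingAlgebra.mkAlgHom K g) :=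
  RingCon.mkₐ_surjective _

theorem adamsTwo_commutator_mem (a b : UniversalEnvelopingAlgebra K g) :
    adamsTwo K g (a * b - b * a) ∈ commSpan K g := by
  obtain ⟨a, rfl⟩ := UniversalEnvelopingAlgebra.mkAlgHom_surjective a
  induction a using TensorAlgebra.induction generalizing b with
  | algebraMap r =>
    rw [AlgHom.commutes, Algebra.commutes, sub_self, map_zero]
    exact zero_mem _
  | ι x =>
    rw [← UniversalEnvelopingAlgebra.ι_apply, adamsTwo_apply, map_sub, map_mul, map_mul,
      envelopingComul_ι, mul'_commutator_primitive]
    exact commutator_mem_commSpan _ _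
  | mul a₁ a₂ h₁ h₂ =>
    have key (p q : UniversalEnvelopingAlgebra K g) :
        p * q * b - b * (p * q) = (p * (q * b) - q * b * p) + (q * (b * p) - b * p * q) := by
      simp only [mul_assoc]
      abel
    rw [map_mul, key, map_add]
    exact add_mem (h₁ _) (h₂ _)
  | add a₁ a₂ h₁ h₂ =>
    rw [map_add, add_mul, mul_add, add_sub_add_comm, map_add]
    exact add_mem (h₁ _) (h₂ _)

theorem commSpan_le_comap_adamsTwo :
    commSpan K g ≤ (commSpan K g).comap (adamsTwo K g) := by
  refine Submodule.span_le.mpr ?_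
  rintro _ ⟨a, b, rfl⟩
  exact adamsTwo_commutator_mem a b

variable (K g) in
/-- The operation induced by `adamsTwo` on `|U(g)|`. -/
def traceAdamsTwo : Module.End K (UniversalEnvelopingAlgebra K g ⧸ commSpan K g) :=
  (commSpan K g).mapQ (commSpan K g) (adamsTwo K g) commSpan_le_comap_adamsTwo

theorem traceAdamsTwo_tr_ι_pow (x : g) (m : ℕ) :
    traceAdamsTwo K g (tr K g (UniversalEnvelopingAlgebra.ι K x ^ m)) =
      (2 : K) ^ m • tr K g (UniversalEnvelopingAlgebra.ι K x ^ m) := by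
  rw [← map_smul, ← adamsTwo_ι_pow]
  rfl

end AdamsOperation

theorem stmt1 [CharZero K] (u v : g) (N : ℕ)
    (h : ∑ m ∈ Finset.range (N + 1),
           ((m.factorial : K)⁻¹) • tr K g ((UniversalEnvelopingAlgebra.ι K u) ^ m)
       = ∑ m ∈ Finset.range (N + 1),
           ((m.factorial : K)⁻¹) • tr K g ((UniversalEnvelopingAlgebra.ι K v) ^ m)) :
    ∀ m ≤ N, tr K g ((UniversalEnvelopingAlgebra.ι K u) ^ m)
           = tr K g ((UniversalEnvelopingAlgebra.ι K v) ^ m) := by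
  set d : ℕ → UniversalEnvelopingAlgebra K g ⧸ commSpan K g := fun m =>
    ((m.factorial : K)⁻¹) • (tr K g (UniversalEnvelopingAlgebra.ι K u ^ m) -
      tr K g (UniversalEnvelopingAlgebra.ι K v ^ m)) with hd
  have hinj : Function.Injective fun m : ℕ => (2 : K) ^ m := fun i j hij => by
    dsimp only at hij
    exact Nat.pow_right_injective le_rfl (by exact_mod_cast hij)
  have hind := (traceAdamsTwo K g).eigenspaces_iSupIndep.comp hinj
  have hmem (m : ℕ) : d m ∈ (traceAdamsTwo K g).eigenspace ((2 : K) ^ m) := by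
    refine Submodule.smul_mem _ _ (Module.End.mem_eigenspace_iff.mpr ?_)
    rw [map_sub, traceAdamsTwo_tr_ι_pow, traceAdamsTwo_tr_ι_pow, smul_sub]
  have hsum : ∑ m ∈ Finset.range (N + 1), d m = 0 := by
    simp only [hd, smul_sub, Finset.sum_sub_distrib, h, sub_self]
  intro m hm
  have hzero : d m = 0 :=
    (iSupIndep_iff_finsetSum_eq_zero_imp_eq_zero _).mp hind (Finset.range (N + 1)) d
      (fun m _ => hmem m) hsum m (Finset.mem_range_succ_iff.mpr hm)
  exact sub_eq_zero.mp ((smul_eq_zero_iff_right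
    (inv_ne_zero (Nat.cast_ne_zero.mpr m.factorial_ne_zero))).mp hzero)

end
end

section
/- Let g be a Lie algebra over a field K of characteristic zero, u, v_0, v_1, …, v_n ∈ g, and N ≥ 0 an integer. Suppose Σ_{m=0}^{N} (1/m!)·|ι(u)^m| lies in the K-linear span of the set {|ι(v_j)^k| : 0 ≤ j ≤ n, k ≥ 0} inside |U(g)|. Then for every 0 ≤ m ≤ N, the element |ι(u)^m| lies in the K-linear span of {|ι(v_0)^m|, |ι(v_1)^m|, …, |ι(v_n)^m|}. (This is the finite-degree form of Theorem 3.3, whose completed version states: if |exp(u)| ∈ |Σ_{j=0}^n K[[v_j]]| then |u^m| ∈ Σ_{j=0}^n K·|v_j^m| for all m ≥ 0.) -/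
/-!
STATEMENT 2 (finite-degree form of Theorem 3.3): if
`Σ_{m=0}^{N} (1/m!)·|ι(u)^m|` lies in the span of `{|ι(v_j)^k| : 0 ≤ j ≤ n, k ≥ 0}`,
then `|ι(u)^m|` lies in the span of `{|ι(v_j)^m| : 0 ≤ j ≤ n}` for every `0 ≤ m ≤ N`.
-/

noncomputable section

variable (K : Type*) [Field K] (g : Type*) [LieRing g] [LieAlgebra K g]

section Adams

attribute [local instance] LieRing.ofAssociativeRing

open scoped TensorProduct in
/-- The coproduct of `U(g)`, the algebra morphism determined by `x ↦ x ⊗ 1 + 1 ⊗ x`. -/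
def coproduct : UniversalEnvelopingAlgebra K g →ₐ[K]
    UniversalEnvelopingAlgebra K g ⊗[K] UniversalEnvelopingAlgebra K g :=
  UniversalEnvelopingAlgebra.lift K
    { toLinearMap :=
        (TensorProduct.mk K _ _).flip 1 ∘ₗ (UniversalEnvelopingAlgebra.ι K (L := g) : g →ₗ[K] _) +
          TensorProduct.mk K _ _ 1 ∘ₗ (UniversalEnvelopingAlgebra.ι K (L := g) : g →ₗ[K] _)
      map_lie' := by
        intro x y
        simp [LieRing.of_associative_ring_bracket, TensorProduct.tmul_sub, add_mul,
          mul_add]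
        abel }

/-- The second Adams operation on `U(g)`, the convolution square of the identity. -/
def adams : Module.End K (UniversalEnvelopingAlgebra K g) :=
  LinearMap.mul' K _ ∘ₗ (coproduct K g).toLinearMap

variable {g}

open scoped TensorProduct in
theorem coproduct_ι (x : g) :
    coproduct K g (UniversalEnvelopingAlgebra.ι K x) =
      UniversalEnvelopingAlgebra.ι K x ⊗ₜ 1 + 1 ⊗ₜ UniversalEnvelopingAlgebra.ι K x := by
  rw [coproduct, UniversalEnvelopingAlgebra.lift_ι_apply]
  rfl

open scoped TensorProduct in
theorem mul'_add_tmul_pow_mul {A : Type*} [Ring A] [Algebra K A] (x : A) (m a b : ℕ) :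
    LinearMap.mul' K A ((x ⊗ₜ[K] 1 + 1 ⊗ₜ[K] x) ^ m * ((x ^ a) ⊗ₜ[K] (x ^ b))) =
      (2 : K) ^ m • x ^ (a + b + m) := by
  induction m generalizing a b with
  | zero => simp [pow_add]
  | succ m ih =>
    rw [pow_succ, mul_assoc, add_mul, Algebra.TensorProduct.tmul_mul_tmul,
      Algebra.TensorProduct.tmul_mul_tmul, one_mul, one_mul, ← pow_succ', ← pow_succ', mul_add,
      map_add, ih, ih, show a + 1 + b + m = a + b + (m + 1) by ring,
      show a + (b + 1) + m = a + b + (m + 1) by ring, ← two_smul K, smul_smul, ← pow_succ']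

theorem adams_ι_pow (x : g) (m : ℕ) :
    adams K g (UniversalEnvelopingAlgebra.ι K x ^ m) =
      (2 : K) ^ m • UniversalEnvelopingAlgebra.ι K x ^ m := by
  have h := mul'_add_tmul_pow_mul K (UniversalEnvelopingAlgebra.ι K x) m 0 0
  rwa [← coproduct_ι, ← map_pow, pow_zero, ← Algebra.TensorProduct.one_def, mul_one, add_zero,
    zero_add] at h

open scoped TensorProduct in
theorem mul'_commutator {A : Type*} [Ring A] [Algebra K A] (x : A) (t : A ⊗[K] A) :
    LinearMap.mul' K A ((x ⊗ₜ[K] 1 + 1 ⊗ₜ[K] x) * t - t * (x ⊗ₜ[K] 1 + 1 ⊗ₜ[K] x)) =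
      x * LinearMap.mul' K A t - LinearMap.mul' K A t * x := by
  induction t with
  | zero => simp
  | tmul a b =>
    simp only [add_mul, mul_add, Algebra.TensorProduct.tmul_mul_tmul, one_mul, mul_one, map_sub,
      map_add, LinearMap.mul'_apply, mul_assoc]
    abel
  | add s t hs ht =>
    rw [mul_add, add_mul s, add_sub_add_comm, map_add, hs, ht, map_add, mul_add, add_mul,
      add_sub_add_comm]

theorem adams_commutator_ι (x : g) (b : UniversalEnvelopingAlgebra K g) :
    adams K g (UniversalEnvelopingAlgebra.ι K x * b - b * UniversalEnvelopingAlgebra.ι K x) =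
      UniversalEnvelopingAlgebra.ι K x * adams K g b -
        adams K g b * UniversalEnvelopingAlgebra.ι K x := by
  have h := mul'_commutator K (UniversalEnvelopingAlgebra.ι K x) (coproduct K g b)
  rwa [← coproduct_ι, ← map_mul, ← map_mul, ← map_sub] at h

theorem UniversalEnvelopingAlgebra.adjoin_range_ι :
    Algebra.adjoin K (Set.range (UniversalEnvelopingAlgebra.ι K (L := g))) = ⊤ := by
  let S := Algebra.adjoin K (Set.range (UniversalEnvelopingAlgebra.ι K (L := g)))
  let f : g →ₗ⁅K⁆ S :=
    { toLinearMap := LinearMap.codRestrict (Subalgebra.toSubmodule S)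
        (UniversalEnvelopingAlgebra.ι K : g →ₗ⁅K⁆ _).toLinearMap
        fun x ↦ Algebra.subset_adjoin ⟨x, rfl⟩
      map_lie' := by
        intro x y
        exact Subtype.ext ((UniversalEnvelopingAlgebra.ι K).map_lie x y) }
  have hf : S.val.comp (UniversalEnvelopingAlgebra.lift K f) = AlgHom.id K _ := by
    apply UniversalEnvelopingAlgebra.hom_ext
    ext x
    change ((UniversalEnvelopingAlgebra.lift K f (UniversalEnvelopingAlgebra.ι K x) : S) :
      UniversalEnvelopingAlgebra K g) = UniversalEnvelopingAlgebra.ι K x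
    rw [UniversalEnvelopingAlgebra.lift_ι_apply]
    rfl
  refine eq_top_iff.2 fun a _ ↦ ?_
  have ha : (UniversalEnvelopingAlgebra.lift K f a : UniversalEnvelopingAlgebra K g) = a :=
    DFunLike.congr_fun hf a
  exact ha ▸ (UniversalEnvelopingAlgebra.lift K f a).2

theorem commSpan_le_comap_adams : commSpan K g ≤ (commSpan K g).comap (adams K g) := by
  refine Submodule.span_le.2 ?_
  rintro _ ⟨a, b, rfl⟩
  have ha : a ∈ Algebra.adjoin K (Set.range (UniversalEnvelopingAlgebra.ι K (L := g))) := by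
    rw [UniversalEnvelopingAlgebra.adjoin_range_ι]
    trivial
  induction ha using Algebra.adjoin_induction generalizing b with
  | mem a ha =>
    obtain ⟨x, rfl⟩ := ha
    refine Submodule.subset_span ⟨_, adams K g b, adams_commutator_ι K x b⟩
  | algebraMap r => simp [Algebra.commutes]
  | add a a' _ _ h h' =>
    rw [add_mul, mul_add, add_sub_add_comm]
    exact add_mem (h b) (h' b)
  | mul a a' _ _ h h' =>
    rw [show a * a' * b - b * (a * a') =
      (a * (a' * b) - a' * b * a) + (a' * (b * a) - b * a * a') by noncomm_ring]
    exact add_mem (h _) (h' _)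

variable (g) in
/-- The endomorphism of `|U(g)|` induced by the second Adams operation. -/
def trAdams : Module.End K (UniversalEnvelopingAlgebra K g ⧸ commSpan K g) :=
  (commSpan K g).mapQ _ (adams K g) (commSpan_le_comap_adams K)

theorem tr_ι_pow_mem_eigenspace (x : g) (m : ℕ) :
    tr K g (UniversalEnvelopingAlgebra.ι K x ^ m) ∈ (trAdams K g).eigenspace ((2 : K) ^ m) := by
  rw [Module.End.mem_eigenspace_iff, tr, trAdams, Submodule.mkQ_apply, Submodule.mapQ_apply,
    adams_ι_pow, Submodule.Quotient.mk_smul]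

variable {K} in
theorem iSupIndep.mem_of_sum_mem_iSup {ι V : Type*} [AddCommGroup V] [Module K V]
    {A B : ι → Submodule K V} (hA : iSupIndep A) (hB : ∀ i, B i ≤ A i) {s : Finset ι} {x : ι → V}
    (hx : ∀ i ∈ s, x i ∈ A i) (h : ∑ i ∈ s, x i ∈ ⨆ i, B i) : ∀ i ∈ s, x i ∈ B i := by
  classical
  obtain ⟨f, hf, hfx⟩ := (Submodule.mem_iSup_iff_exists_finsupp B _).1 h
  have key := (iSupIndep_iff_finsetSum_eq_imp_eq A).1 hA (s ∪ f.support)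
    (fun i ↦ if i ∈ s then x i else 0) f (fun i _ ↦ ⟨?_, hB i (hf i)⟩) ?_
  · intro i hi
    have := key i (Finset.mem_union_left _ hi)
    rw [if_pos hi] at this
    exact this ▸ hf i
  · split_ifs with hi
    exacts [hx i hi, zero_mem _]
  · rw [Finset.sum_ite_mem, Finset.inter_eq_right.2 Finset.subset_union_left, ← hfx]
    exact Finsupp.sum_of_support_subset f Finset.subset_union_right _ fun _ _ ↦ rfl

end Adams

theorem stmt2 [CharZero K] (u : g) (n N : ℕ) (v : Fin (n + 1) → g)
    (h : ∑ m ∈ Finset.range (N + 1),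
           ((m.factorial : K)⁻¹) • tr K g ((UniversalEnvelopingAlgebra.ι K u) ^ m)
         ∈ Submodule.span K
             {y : UniversalEnvelopingAlgebra K g ⧸ commSpan K g |
               ∃ (j : Fin (n + 1)) (k : ℕ),
                 y = tr K g ((UniversalEnvelopingAlgebra.ι K (v j)) ^ k)}) :
    ∀ m ≤ N, tr K g ((UniversalEnvelopingAlgebra.ι K u) ^ m)
        ∈ Submodule.span K
            {y : UniversalEnvelopingAlgebra K g ⧸ commSpan K g |
              ∃ j : Fin (n + 1),
                y = tr K g ((UniversalEnvelopingAlgebra.ι K (v j)) ^ m)} := by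
  have hinj : Function.Injective fun m : ℕ ↦ (2 : K) ^ m := fun a b hab ↦
    Nat.pow_right_injective le_rfl (Nat.cast_injective (R := K) (by simpa using hab))
  have hind := (trAdams K g).eigenspaces_iSupIndep.comp hinj
  intro m hm
  have hmem := hind.mem_of_sum_mem_iSup
    (B := fun m ↦ Submodule.span K {y | ∃ j : Fin (n + 1),
      y = tr K g (UniversalEnvelopingAlgebra.ι K (v j) ^ m)})
    (fun k ↦ Submodule.span_le.2 ?_)
    (fun k _ ↦ Submodule.smul_mem _ _ (tr_ι_pow_mem_eigenspace K u k))
    (Submodule.span_le.2 ?_ h) m (Finset.mem_range_succ_iff.2 hm)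
  · exact (Submodule.smul_mem_iff _ (inv_ne_zero (Nat.cast_ne_zero.2 m.factorial_ne_zero))).1 hmem
  · rintro _ ⟨j, rfl⟩
    exact tr_ι_pow_mem_eigenspace K (v j) k
  · rintro _ ⟨j, k, rfl⟩
    exact Submodule.mem_iSup_of_mem k (Submodule.subset_span ⟨j, rfl⟩)

end
end

section
/- Let K be a field of characteristic zero, V a finite-dimensional K-vector space, and let z ∈ T(V) be either a nonzero element of V, or a nonzero antisymmetric 2-tensor (a nonzero element of Λ²V). Then {a ∈ T(V) : za − az ∈ K[z]} = K[z]; in particular the centralizer of z in T(V) is K[z]. (Equation (3.4), used in the proofs of Lemmas 3.6 and 3.7; it is Proposition 5.6 of [AKKN, higher genus], stated in the uncompleted tensor algebra, which is equivalent to the completed version since z is homogeneous.) -/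
/-!
STATEMENT 12 (equation (3.4), Proposition 5.6 of [AKKN, higher genus]): if `z` is a nonzero
element of `V`, or a nonzero antisymmetric 2-tensor, then
`{a ∈ T(V) : za − az ∈ K[z]} = K[z]`.
-/

noncomputable section

variable (K : Type*) [Field K] [CharZero K]
variable (V : Type*) [AddCommGroup V] [Module K V]

/-- The subalgebra `K[z]` of `T(V)`: the linear span of the powers of `z`. -/
def powerSpan (z : TensorAlgebra K V) : Submodule K (TensorAlgebra K V) :=
  Submodule.span K (Set.range fun i : ℕ => z ^ i)

/-- The subspace `Λ²V ⊆ V^{⊗2}` of antisymmetric 2-tensors. -/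
def lambdaTwo : Submodule K (TensorAlgebra K V) :=
  Submodule.span K
    {x | ∃ v w : V, x = TensorAlgebra.ι K v * TensorAlgebra.ι K w
                      - TensorAlgebra.ι K w * TensorAlgebra.ι K v}

/-! ### Leading monomials in the algebra of an ordered monoid -/

namespace MonoidAlgebra

variable {F M : Type*} [Field F] [LinearOrder M]

/-- The monomial `u` is the leading monomial of `a`. -/
def IsLeading (a : MonoidAlgebra F M) (u : M) : Prop :=
  IsGreatest (a.coeff.support : Set M) u

theorem isLeading_iff {a : MonoidAlgebra F M} {u : M} :
    IsLeading a u ↔ a.coeff u ≠ 0 ∧ ∀ v, u < v → a.coeff v = 0 := by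
  simp only [IsLeading, IsGreatest, mem_upperBounds, Finset.mem_coe, Finsupp.mem_support_iff]
  refine and_congr_right fun _ => forall_congr' fun v => ?_
  rw [← not_lt, not_imp_not]

theorem exists_isLeading {a : MonoidAlgebra F M} (ha : a ≠ 0) : ∃ u, IsLeading a u := by
  have h : a.coeff.support.Nonempty := by
    rwa [Finsupp.support_nonempty_iff, ne_eq, coeff_eq_zero]
  exact ⟨_, a.coeff.support.isGreatest_max' h⟩

theorem IsLeading.unique {a : MonoidAlgebra F M} {u v : M} (hu : IsLeading a u)
    (hv : IsLeading a v) : u = v :=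
  IsGreatest.unique hu hv

theorem IsLeading.sub {a b : MonoidAlgebra F M} {u v : M} (ha : IsLeading a u)
    (hb : IsLeading b v) (h : u ≠ v) : IsLeading (a - b) (max u v) := by
  rw [isLeading_iff] at *
  simp only [coeff_sub, Finsupp.sub_apply]
  rcases h.lt_or_gt with h | h
  · rw [max_eq_right h.le]
    exact ⟨by simpa [ha.2 v h] using hb.1,
      fun w hw => by rw [ha.2 w (h.trans hw), hb.2 w hw, sub_zero]⟩
  · rw [max_eq_left h.le]
    exact ⟨by simpa [hb.2 u h] using ha.1,
      fun w hw => by rw [hb.2 w (h.trans hw), ha.2 w hw, sub_zero]⟩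

theorem isLeading_one [Monoid M] : IsLeading (1 : MonoidAlgebra F M) 1 := by
  rw [IsLeading, support_coeff_one, Finset.coe_one]
  exact isGreatest_singleton

variable [Monoid M] [MulLeftStrictMono M] [MulRightStrictMono M]

theorem IsLeading.mul {a b : MonoidAlgebra F M} {u v : M} (ha : IsLeading a u)
    (hb : IsLeading b v) : IsLeading (a * b) (u * v) := by
  classical
  constructor
  · have h : UniqueMul a.coeff.support b.coeff.support u v := by
      intro x y hx hy hxy
      have hxu := ha.2 (Finset.mem_coe.2 hx)
      have hyv := hb.2 (Finset.mem_coe.2 hy)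
      exact (mul_eq_mul_iff_eq_and_eq hxu hyv).1 hxy
    rw [Finset.mem_coe, Finsupp.mem_support_iff, coeff_mul_mul_of_uniqueMul h]
    exact mul_ne_zero (Finsupp.mem_support_iff.1 ha.1) (Finsupp.mem_support_iff.1 hb.1)
  · intro w hw
    obtain ⟨x, hx, y, hy, rfl⟩ := Finset.mem_mul.1 (support_coeff_mul_subset a b hw)
    have := mulLeftMono_of_mulLeftStrictMono M
    have := mulRightMono_of_mulRightStrictMono M
    exact mul_le_mul' (ha.2 hx) (hb.2 hy)

theorem IsLeading.pow {a : MonoidAlgebra F M} {u : M} (ha : IsLeading a u) (n : ℕ) :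
    IsLeading (a ^ n) (u ^ n) := by
  induction n with
  | zero => simpa using isLeading_one
  | succ n ih => rw [pow_succ, pow_succ]; exact ih.mul ha

theorem IsLeading.aeval {z : MonoidAlgebra F M} {u : M} (hz : IsLeading z u) (hu : 1 < u)
    {p : Polynomial F} (hp : p ≠ 0) : IsLeading (Polynomial.aeval z p) (u ^ p.natDegree) := by
  have := mulLeftMono_of_mulLeftStrictMono M
  have hlow : ∀ v, u ^ p.natDegree ≤ v →
      (∑ i ∈ Finset.range p.natDegree, p.coeff i • z ^ i).coeff v = 0 := by
    intro v hv
    rw [coeff_sum, Finsupp.finsetSum_apply]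
    refine Finset.sum_eq_zero fun i hi => ?_
    have hi' : u ^ i < v := (pow_lt_pow_right' hu (Finset.mem_range.1 hi)).trans_le hv
    rw [coeff_smul_apply, (isLeading_iff.1 (hz.pow i)).2 v hi', smul_zero]
  rw [isLeading_iff, Polynomial.aeval_eq_sum_range, Finset.sum_range_succ]
  have hlead := isLeading_iff.1 (hz.pow p.natDegree)
  refine ⟨?_, fun v hv => ?_⟩
  · rw [coeff_add, Finsupp.add_apply, hlow _ le_rfl, zero_add, coeff_smul_apply]
    exact smul_ne_zero (Polynomial.leadingCoeff_ne_zero.2 hp) hlead.1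
  · rw [coeff_add, Finsupp.add_apply, hlow _ hv.le, zero_add, coeff_smul_apply, hlead.2 v hv,
      smul_zero]

/-- If the leading monomial `u` of `z` commutes only with its own powers, then every `a` whose
commutator with `z` is a polynomial in `z` is itself a polynomial in `z`. -/
theorem IsLeading.mem_adjoin_of_commutator_mem [WellFoundedLT M] [IsCancelMul M]
    {z : MonoidAlgebra F M} {u : M}
    (hz : IsLeading z u) (hu : 1 < u) (hcent : ∀ w, u * w = w * u → ∃ n, w = u ^ n)
    {a : MonoidAlgebra F M} (ha : z * a - a * z ∈ Algebra.adjoin F {z}) :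
    a ∈ Algebra.adjoin F {z} := by
  by_cases ha0 : a = 0
  · exact ha0 ▸ zero_mem _
  obtain ⟨w, hw⟩ := exists_isLeading ha0
  induction w using WellFoundedLT.induction generalizing a with
  | ind w ih =>
    have hcomm : u * w = w * u := by
      by_contra hne
      have hlead := (hz.mul hw).sub (hw.mul hz) hne
      rw [Algebra.adjoin_singleton_eq_range_aeval] at ha
      obtain ⟨p, hp⟩ := ha
      have hp0 : p ≠ 0 := by
        rintro rfl
        rw [← hp] at hlead
        simpa using hlead.1
      rw [← hp] at hlead
      have heq := hlead.unique (hz.aeval hu hp0)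
      have hpow : Commute u (u ^ p.natDegree) := (Commute.refl u).pow_right _
      rw [← heq] at hpow
      rcases max_choice (u * w) (w * u) with h | h
      · rw [h, commute_iff_eq, mul_assoc u w u] at hpow
        exact hne (mul_left_cancel hpow)
      · rw [h, commute_iff_eq, ← mul_assoc] at hpow
        exact hne (mul_right_cancel hpow)
    obtain ⟨n, rfl⟩ := hcent w hcomm
    have hzn := hz.pow n
    set c := a.coeff (u ^ n) / (z ^ n).coeff (u ^ n) with hc
    have hmem : c • z ^ n ∈ Algebra.adjoin F {z} :=
      Subalgebra.smul_mem _ (pow_mem (Algebra.self_mem_adjoin_singleton F z) n) c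
    suffices h : a - c • z ^ n ∈ Algebra.adjoin F {z} by simpa using add_mem h hmem
    by_cases hb0 : a - c • z ^ n = 0
    · exact hb0 ▸ zero_mem _
    obtain ⟨v, hv⟩ := exists_isLeading hb0
    refine ih v ?_ ?_ hb0 hv
    · by_contra hlt
      refine (isLeading_iff.1 hv).1 ?_
      rw [coeff_sub, Finsupp.sub_apply, coeff_smul_apply]
      rcases (not_lt.1 hlt).eq_or_lt with rfl | h
      · rw [hc, smul_eq_mul, div_mul_cancel₀ _ (isLeading_iff.1 hzn).1, sub_self]
      · rw [(isLeading_iff.1 hw).2 v h, (isLeading_iff.1 hzn).2 v h, smul_zero, sub_zero]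
    · have : z * (a - c • z ^ n) - (a - c • z ^ n) * z = z * a - a * z := by
        rw [mul_sub, sub_mul, mul_smul_comm, smul_mul_assoc, ← pow_succ, ← pow_succ']
        abel
      rwa [this]

end MonoidAlgebra

/-! ### A well-founded monoid order on words -/

namespace FreeMonoid

/-- The number whose base `n + 2` digits are the (shifted) letters of `w`, most significant
digit first. -/
def numeral {n : ℕ} (w : FreeMonoid (Fin n)) : ℕ :=
  Nat.ofDigits (n + 2) ((toList w).reverse.map fun i => i.val + 1)

variable {n : ℕ}

theorem digits_numeral (w : FreeMonoid (Fin n)) :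
    Nat.digits (n + 2) (numeral w) = (toList w).reverse.map fun i => i.val + 1 := by
  refine Nat.digits_ofDigits _ (by omega) _ ?_ ?_
  · simp only [List.mem_map]
    rintro _ ⟨i, -, rfl⟩
    omega
  · intro h
    obtain ⟨i, -, hi⟩ := List.mem_map.1 (List.getLast_mem h)
    omega

theorem numeral_injective : Function.Injective (numeral (n := n)) := by
  intro v w h
  have := congrArg (Nat.digits (n + 2)) h
  rw [digits_numeral, digits_numeral] at this
  have hinj : Function.Injective fun i : Fin n => i.val + 1 := fun i j hij =>
    Fin.ext (Nat.succ_injective hij)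
  exact toList.injective (List.reverse_injective (List.map_injective_iff.2 hinj this))

theorem length_le_of_numeral_le {v w : FreeMonoid (Fin n)}
    (h : numeral v ≤ numeral w) : v.length ≤ w.length := by
  have := Nat.le_length_digits_le (n + 2) _ _ h
  rw [digits_numeral, digits_numeral] at this
  simpa [FreeMonoid.length] using this

theorem numeral_mul (v w : FreeMonoid (Fin n)) :
    numeral (v * w) = numeral w + (n + 2) ^ w.length * numeral v := by
  simp [numeral, Nat.ofDigits_append, FreeMonoid.length]

/-- The order on words comparing them as numerals; this is the shortlex order. -/
abbrev numeralOrder : LinearOrder (FreeMonoid (Fin n)) :=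
  LinearOrder.lift' numeral numeral_injective

attribute [local instance] numeralOrder

theorem lt_iff_numeral_lt {v w : FreeMonoid (Fin n)} :
    v < w ↔ numeral v < numeral w := Iff.rfl

instance : WellFoundedLT (FreeMonoid (Fin n)) :=
  ⟨InvImage.wf numeral Nat.lt_wfRel.wf⟩

instance : MulLeftStrictMono (FreeMonoid (Fin n)) := by
  refine ⟨fun u v w h => ?_⟩
  rw [lt_iff_numeral_lt] at h
  change numeral (u * v) < numeral (u * w)
  rw [numeral_mul, numeral_mul]
  exact add_lt_add_of_lt_of_le h (Nat.mul_le_mul_right _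
    (Nat.pow_le_pow_right (by omega) (length_le_of_numeral_le h.le)))

instance : MulRightStrictMono (FreeMonoid (Fin n)) := by
  refine ⟨fun u v w h => ?_⟩
  rw [lt_iff_numeral_lt] at h
  change numeral (v * u) < numeral (w * u)
  rw [numeral_mul, numeral_mul]
  gcongr

theorem one_lt_of_ne_one {w : FreeMonoid (Fin n)} (hw : w ≠ 1) : 1 < w := by
  refine lt_of_le_of_ne ?_ hw.symm
  change numeral 1 ≤ numeral w
  simp [numeral]

theorem eq_pow_of_mul_comm {α : Type*} {u : FreeMonoid α} (hu : u ≠ 1)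
    (hshort : ∀ w : FreeMonoid α, w.length < u.length → u * w = w * u → w = 1)
    {w : FreeMonoid α} (h : u * w = w * u) : ∃ n, w = u ^ n := by
  induction hl : w.length using Nat.strong_induction_on generalizing w with
  | _ l ih =>
    rcases lt_or_ge w.length u.length with hlt | hge
    · exact ⟨0, by rw [hshort w hlt h, pow_zero]⟩
    · have hpre : toList u <+: toList w :=
        List.prefix_of_prefix_length_le (l₃ := toList (u * w)) ⟨toList w, rfl⟩
          (h ▸ ⟨toList u, rfl⟩) hge
      obtain ⟨t, ht⟩ := hpre
      obtain rfl : u * ofList t = w := ht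
      have hpos : 0 < u.length := by
        rw [Nat.pos_iff_ne_zero, ne_eq, length_eq_zero]
        exact hu
      rw [mul_assoc] at h
      obtain ⟨n, hn⟩ := ih (ofList t).length (by rw [← hl, length_mul]; omega)
        (mul_left_cancel h) rfl
      exact ⟨n + 1, by rw [hn, pow_succ']⟩

theorem eq_pow_of_mul_comm_of {α : Type*} (x : α) {w : FreeMonoid α}
    (h : of x * w = w * of x) : ∃ n, w = of x ^ n := by
  refine eq_pow_of_mul_comm (of_ne_one x) (fun v hv _ => ?_) h
  rwa [length_of, Nat.lt_one_iff, length_eq_zero] at hv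

theorem of_mul_of_ne_one {α : Type*} (x y : α) : of x * of y ≠ 1 := fun h => by
  simpa using congrArg length h

theorem eq_pow_of_mul_comm_of_mul_of {α : Type*} {x y : α} (hxy : x ≠ y) {w : FreeMonoid α}
    (h : of x * of y * w = w * (of x * of y)) : ∃ n, w = (of x * of y) ^ n := by
  refine eq_pow_of_mul_comm (of_mul_of_ne_one x y) (fun v hv hcomm => ?_) h
  rw [length_mul, length_of, length_of] at hv
  by_contra hne
  have hv1 : v.length = 1 := by
    have := mt length_eq_zero.1 hne
    omega
  obtain ⟨t, rfl⟩ := length_eq_one.1 hv1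
  have hlist : [x, y, t] = [t, x, y] := hcomm
  simp only [List.cons.injEq] at hlist
  exact hxy hlist.2.1.symm

end FreeMonoid

/-! ### Coordinates on the tensor algebra -/

namespace TensorAlgebra

variable {F W : Type*} [Field F] [AddCommGroup W] [Module F W] {n : ℕ}

/-- A basis identifies the tensor algebra with the algebra of the free monoid of words. -/
def equivWords (b : Module.Basis (Fin n) F W) :
    TensorAlgebra F W ≃ₐ[F] MonoidAlgebra F (FreeMonoid (Fin n)) :=
  (equivFreeAlgebra b).trans FreeAlgebra.equivMonoidAlgebraFreeMonoid

theorem equivWords_ι_basis (b : Module.Basis (Fin n) F W) (i : Fin n) :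
    equivWords b (ι F (b i)) = MonoidAlgebra.single (FreeMonoid.of i) 1 := by
  simp [equivWords, FreeAlgebra.equivMonoidAlgebraFreeMonoid]

theorem equivWords_ι (b : Module.Basis (Fin n) F W) (v : W) :
    equivWords b (ι F v) = ∑ i, MonoidAlgebra.single (FreeMonoid.of i) (b.repr v i) := by
  conv_lhs => rw [← b.sum_repr v]
  simp only [map_sum, map_smul, equivWords_ι_basis, MonoidAlgebra.smul_single, smul_eq_mul,
    mul_one]

theorem equivWords_ι_coeff_ne_zero (b : Module.Basis (Fin n) F W) {v : W}
    {w : FreeMonoid (Fin n)} (hw : (equivWords b (ι F v)).coeff w ≠ 0) :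
    ∃ i, w = FreeMonoid.of i := by
  rw [equivWords_ι, MonoidAlgebra.coeff_sum, Finsupp.finsetSum_apply] at hw
  obtain ⟨i, -, hi⟩ := Finset.exists_ne_zero_of_sum_ne_zero hw
  rw [MonoidAlgebra.coeff_single, Finsupp.single_apply_ne_zero] at hi
  exact ⟨i, hi.1⟩

theorem equivWords_commutator (b : Module.Basis (Fin n) F W) (v w : W) :
    equivWords b (ι F v * ι F w - ι F w * ι F v) =
      ∑ i, ∑ j, MonoidAlgebra.single (FreeMonoid.of i * FreeMonoid.of j)
        (b.repr v i * b.repr w j - b.repr w i * b.repr v j) := by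
  simp only [map_sub, map_mul, equivWords_ι, Finset.sum_mul_sum, MonoidAlgebra.single_mul_single,
    MonoidAlgebra.single_sub, Finset.sum_sub_distrib]

theorem equivWords_lambdaTwo_coeff_ne_zero (b : Module.Basis (Fin n) F W)
    {z : TensorAlgebra F W} (hz : z ∈ lambdaTwo F W) {w : FreeMonoid (Fin n)}
    (hw : (equivWords b z).coeff w ≠ 0) :
    ∃ i j, i ≠ j ∧ w = FreeMonoid.of i * FreeMonoid.of j := by
  contrapose! hw
  induction hz using Submodule.span_induction with
  | mem x hx =>
    obtain ⟨v, v', rfl⟩ := hx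
    rw [equivWords_commutator, MonoidAlgebra.coeff_sum, Finsupp.finsetSum_apply]
    refine Finset.sum_eq_zero fun i _ => ?_
    rw [MonoidAlgebra.coeff_sum, Finsupp.finsetSum_apply]
    refine Finset.sum_eq_zero fun j _ => ?_
    rw [MonoidAlgebra.coeff_single]
    rcases eq_or_ne i j with rfl | hij
    · rw [mul_comm, sub_self, Finsupp.single_zero, Finsupp.zero_apply]
    · rw [Finsupp.single_eq_of_ne (hw i j hij)]
  | zero => simp
  | add x y _ _ hx hy => simp [hx, hy]
  | smul c x _ hx => simp [hx]

attribute [local instance] FreeMonoid.numeralOrder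

/-- The leading monomial of a nonzero vector or antisymmetric 2-tensor is nontrivial and commutes
only with its own powers. -/
theorem leading_equivWords (b : Module.Basis (Fin n) F W) {z : TensorAlgebra F W}
    (hz : z ∈ LinearMap.range (ι F : W →ₗ[F] TensorAlgebra F W) ∨ z ∈ lambdaTwo F W)
    {u : FreeMonoid (Fin n)} (hu : (equivWords b z).IsLeading u) :
    1 < u ∧ ∀ w, u * w = w * u → ∃ k, w = u ^ k := by
  have hu0 := (MonoidAlgebra.isLeading_iff.1 hu).1
  rcases hz with ⟨v, rfl⟩ | hz
  · obtain ⟨i, rfl⟩ := equivWords_ι_coeff_ne_zero b hu0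
    exact ⟨FreeMonoid.one_lt_of_ne_one (FreeMonoid.of_ne_one i),
      fun w => FreeMonoid.eq_pow_of_mul_comm_of i⟩
  · obtain ⟨i, j, hij, rfl⟩ := equivWords_lambdaTwo_coeff_ne_zero b hz hu0
    exact ⟨FreeMonoid.one_lt_of_ne_one (FreeMonoid.of_mul_of_ne_one i j),
      fun w => FreeMonoid.eq_pow_of_mul_comm_of_mul_of hij⟩

theorem mem_adjoin_of_commutator_mem [FiniteDimensional F W]
    {z : TensorAlgebra F W} (hz : z ≠ 0)
    (hz' : z ∈ LinearMap.range (ι F : W →ₗ[F] TensorAlgebra F W) ∨ z ∈ lambdaTwo F W)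
    {a : TensorAlgebra F W} (ha : z * a - a * z ∈ Algebra.adjoin F {z}) :
    a ∈ Algebra.adjoin F {z} := by
  let e := equivWords (Module.finBasis F W)
  have hmem : ∀ x, e x ∈ Algebra.adjoin F {e z} ↔ x ∈ Algebra.adjoin F {z} := fun x => by
    have h := AlgHom.map_adjoin e.toAlgHom {z}
    rw [Set.image_singleton] at h
    change e x ∈ Algebra.adjoin F {e.toAlgHom z} ↔ _
    rw [← h, Subalgebra.mem_map]
    exact ⟨fun ⟨y, hy, hyx⟩ => e.injective hyx ▸ hy, fun hx => ⟨x, hx, rfl⟩⟩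
  obtain ⟨u, hu⟩ := MonoidAlgebra.exists_isLeading ((map_ne_zero_iff e e.injective).2 hz)
  obtain ⟨hu1, hcent⟩ := leading_equivWords _ hz' hu
  rw [← hmem] at ha ⊢
  rw [map_sub, map_mul, map_mul] at ha
  exact hu.mem_adjoin_of_commutator_mem hu1 hcent ha

end TensorAlgebra

theorem powerSpan_eq_adjoin {F W : Type*} [Field F] [AddCommGroup W] [Module F W]
    (z : TensorAlgebra F W) :
    powerSpan F W z = Subalgebra.toSubmodule (Algebra.adjoin F {z}) := by
  rw [Algebra.adjoin_eq_span, ← Submonoid.powers_eq_closure]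
  rfl

theorem stmt12 [FiniteDimensional K V] (z : TensorAlgebra K V) (hz : z ≠ 0)
    (hz' : z ∈ LinearMap.range (TensorAlgebra.ι K : V →ₗ[K] TensorAlgebra K V)
         ∨ z ∈ lambdaTwo K V) :
    {a : TensorAlgebra K V | z * a - a * z ∈ powerSpan K V z}
      = ↑(powerSpan K V z) := by
  ext a
  rw [powerSpan_eq_adjoin]
  refine ⟨TensorAlgebra.mem_adjoin_of_commutator_mem hz hz', fun ha => ?_⟩
  have hself := Algebra.self_mem_adjoin_singleton K z
  exact sub_mem (mul_mem hself ha) (mul_mem ha hself)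

end
end
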